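/- Let p ≥ 3, λ > 0, δ ∈ (0,1), and let n ≥ 2 be even. Draw S = ((x₁,y₁),…,(xₙ,yₙ)) i.i.d. from D and let μ̂ be any minimizer of the L1-regularized objective (λ/2)‖μ‖₁ + R̂_S(μ) over {μ ∈ ℝᵖ : μ ≥ 0 coordinatewise}. Then with probability at least 1 − δ over the draw of S, R(μ̂) ≤ R̂_S(μ̂) + (4‖κ‖_∞/λ) √(2 log p / n) + (1 + 2‖κ‖_∞/λ) √(2 log(1/δ)/n). -/

import Mathlib

open MeasureTheory Finset

noncomputable section

/-- The ±1 real value of a Boolean label: `true ↦ 1`, `false ↦ -1`.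
We encode the label space {−1, 1} by `Bool`. -/
def sgn (b : Bool) : ℝ := if b then 1 else -1

/-- The Euclidean (L2) norm on ℝᵖ. -/
def l2norm {p : ℕ} (μ : Fin p → ℝ) : ℝ := Real.sqrt (∑ i, μ i ^ 2)

/-- The L1 norm on ℝᵖ. -/
def l1norm {p : ℕ} (μ : Fin p → ℝ) : ℝ := ∑ i, |μ i|

/-- The L∞ (supremum) norm on ℝᵖ. -/
def linfnorm {p : ℕ} (μ : Fin p → ℝ) : ℝ := ⨆ i, |μ i|

/-- The standard inner product on ℝᵖ. -/
def ip {p : ℕ} (μ v : Fin p → ℝ) : ℝ := ∑ i, μ i * v i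

/-- The K-space feature map `z(x,x') = (K₁(x,x'),…,K_p(x,x'))`. -/
def zmap {X : Type*} {p : ℕ} (K : Fin p → X → X → ℝ) (x x' : X) : Fin p → ℝ :=
  fun i => K i x x'

/-- The pairwise hinge loss `ℓ(μ, (x,y), (x',y')) = max(0, 1 − y y' ⟨μ, z(x,x')⟩)`. -/
def hinge {X : Type*} {p : ℕ} (K : Fin p → X → X → ℝ) (μ : Fin p → ℝ)
    (w w' : X × Bool) : ℝ :=
  max 0 (1 - sgn w.2 * sgn w'.2 * ip μ (zmap K w.1 w'.1))

/-- The empirical risk `R̂_S(μ) = (2/(n(n−1))) Σ_{1≤i<j≤n} ℓ(μ, (xᵢ,yᵢ), (xⱼ,yⱼ))`. -/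
def empRisk {X : Type*} {p n : ℕ} (K : Fin p → X → X → ℝ)
    (S : Fin n → X × Bool) (μ : Fin p → ℝ) : ℝ :=
  (2 / ((n : ℝ) * ((n : ℝ) - 1))) *
    ∑ i : Fin n, ∑ j : Fin n, if i < j then hinge K μ (S i) (S j) else 0

/-- The true risk `R(μ) = E_{((x,y),(x',y')) ~ D×D}[max(0, 1 − y y' ⟨μ, z(x,x')⟩)]`. -/
def trueRisk {X : Type*} [MeasurableSpace X] {p : ℕ} (K : Fin p → X → X → ℝ)
    (D : Measure (X × Bool)) (μ : Fin p → ℝ) : ℝ :=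
  ∫ w, hinge K μ w.1 w.2 ∂(D.prod D)

/-- Expectation over m i.i.d. Rademacher random variables (uniform on {−1,+1}),
encoded by Booleans mapped to ±1 via `sgn`. -/
def radE {m : ℕ} (f : (Fin m → Bool) → ℝ) : ℝ :=
  (∑ ε : Fin m → Bool, f ε) / 2 ^ m

section FiniteSup

variable {ι : Type*} [Finite ι]

lemma le_ciSup_of_finite (g : ι → ℝ) (i : ι) : g i ≤ ⨆ i, g i :=
  le_ciSup (Set.finite_range g).bddAbove i

variable [Nonempty ι]

lemma integrable_ciSup_of_finite {Ω : Type*} [MeasurableSpace Ω] {P : Measure Ω}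
    {g : ι → Ω → ℝ} (hg : ∀ i, Integrable (g i) P) :
    Integrable (fun ω => ⨆ i, g i ω) P := by
  have := Fintype.ofFinite ι
  refine Integrable.mono' (g := fun ω => ∑ i, |g i ω|) ?_ ?_ ?_
  · exact integrable_finsetSum _ fun i _ => (hg i).abs
  · exact (AEMeasurable.iSup fun i => (hg i).aemeasurable).aestronglyMeasurable
  · refine Filter.Eventually.of_forall fun ω => ?_
    obtain ⟨i, hi⟩ := exists_eq_ciSup_of_finite (f := fun i => g i ω)
    rw [← hi, Real.norm_eq_abs]
    exact Finset.single_le_sum (f := fun i => |g i ω|) (fun i _ => abs_nonneg _)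
      (Finset.mem_univ i)

lemma ciSup_integral_le {Ω : Type*} [MeasurableSpace Ω] {P : Measure Ω}
    {g : ι → Ω → ℝ} (hg : ∀ i, Integrable (g i) P) :
    ⨆ i, ∫ ω, g i ω ∂P ≤ ∫ ω, ⨆ i, g i ω ∂P :=
  ciSup_le fun i => integral_mono (hg i) (integrable_ciSup_of_finite hg)
    fun ω => le_ciSup_of_finite (fun i => g i ω) i

/-- Contraction by the 1-Lipschitz map `x ↦ |1 - x|` against a single random sign. -/
lemma ciSup_add_abs_add_ciSup_sub_abs_le (B x : ι → ℝ) :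
    (⨆ i, (B i + |1 - x i|)) + ⨆ i, (B i - |1 - x i|) ≤
      (⨆ i, (B i + x i)) + ⨆ i, (B i - x i) := by
  obtain ⟨i, hi⟩ := exists_eq_ciSup_of_finite (f := fun i => B i + |1 - x i|)
  obtain ⟨j, hj⟩ := exists_eq_ciSup_of_finite (f := fun i => B i - |1 - x i|)
  rw [← hi, ← hj]
  have h1 := le_ciSup_of_finite (fun i => B i + x i)
  have h2 := le_ciSup_of_finite (fun i => B i - x i)
  have habs : |1 - x i| - |1 - x j| ≤ |x i - x j| := by
    refine (abs_sub_abs_le_abs_sub _ _).trans ?_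
    rw [abs_sub_comm (x i)]
    exact le_of_eq (by ring_nf)
  have hi1 := h1 i
  have hi2 := h2 i
  have hj1 := h1 j
  have hj2 := h2 j
  rcases abs_cases (x i - x j) with ⟨h, -⟩ | ⟨h, -⟩ <;> linarith

end FiniteSup

section PiCons

variable {Z : Type*} [MeasurableSpace Z] (D : Measure Z) [IsProbabilityMeasure D] {n : ℕ}

lemma measurePreserving_finCons :
    MeasurePreserving (fun q : Z × (Fin n → Z) => (Fin.cons q.1 q.2 : Fin (n + 1) → Z))
      (D.prod (Measure.pi fun _ : Fin n => D)) (Measure.pi fun _ : Fin (n + 1) => D) := by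
  have h := (measurePreserving_piFinSuccAbove (fun _ : Fin (n + 1) => D) 0).symm
  convert! h using 1
  ext q i
  simp [MeasurableEquiv.piFinSuccAbove_symm_apply, Fin.insertNthEquiv]

lemma integrable_finCons {F : (Fin (n + 1) → Z) → ℝ}
    (hF : Integrable F (Measure.pi fun _ => D)) :
    Integrable (fun q : Z × (Fin n → Z) => F (Fin.cons q.1 q.2))
      (D.prod (Measure.pi fun _ : Fin n => D)) :=
  (measurePreserving_finCons D).integrable_comp_of_integrable hF

lemma integral_finCons {F : (Fin (n + 1) → Z) → ℝ}
    (hF : Integrable F (Measure.pi fun _ => D)) :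
    ∫ x, F x ∂(Measure.pi fun _ => D) =
      ∫ q : Z × (Fin n → Z), F (Fin.cons q.1 q.2) ∂(D.prod (Measure.pi fun _ : Fin n => D)) := by
  have hm := measurePreserving_finCons D (n := n)
  rw [← hm.map_eq, integral_map hm.measurable.aemeasurable]
  rw [hm.map_eq]
  exact hF.aestronglyMeasurable

end PiCons

section Contraction

variable {ι : Type*} [Finite ι] [Nonempty ι]

lemma integral_ciSup_sum_le {Ω Ω' : Type*} [MeasurableSpace Ω] [MeasurableSpace Ω']
    (P : Measure Ω) [IsProbabilityMeasure P] (P' : Measure Ω') [IsProbabilityMeasure P']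
    (m : ℕ) (c : Fin m → ι → Ω → ℝ) (l : Fin m → ι → Ω' → ℝ)
    (hc : ∀ k i, Integrable (c k i) P) (hl : ∀ k i, Integrable (l k i) P')
    (h : ∀ k (A : ι → ℝ), ∫ ω, ⨆ i, (A i + c k i ω) ∂P ≤ ∫ ω, ⨆ i, (A i + l k i ω) ∂P')
    (A : ι → ℝ) :
    ∫ ω, ⨆ i, (A i + ∑ k, c k i (ω k)) ∂(Measure.pi fun _ : Fin m => P) ≤
      ∫ ω, ⨆ i, (A i + ∑ k, l k i (ω k)) ∂(Measure.pi fun _ : Fin m => P') := by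
  induction m generalizing A with
  | zero => simp
  | succ m ih =>
    have hcm (i) : Integrable (fun ω : Fin m → Ω => ∑ k : Fin m, c k.succ i (ω k))
        (Measure.pi fun _ => P) :=
      integrable_finsetSum _ fun k _ => integrable_comp_eval (μ := fun _ : Fin m => P) (hc k.succ i)
    have hlm (i) : Integrable (fun ω : Fin m → Ω' => ∑ k : Fin m, l k.succ i (ω k))
        (Measure.pi fun _ => P') :=
      integrable_finsetSum _ fun k _ =>
        integrable_comp_eval (μ := fun _ : Fin m => P') (hl k.succ i)
    have hcc (i) : Integrable (fun q : Ω × (Fin m → Ω) =>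
        A i + c 0 i q.1 + ∑ k : Fin m, c k.succ i (q.2 k)) (P.prod (Measure.pi fun _ => P)) :=
      (((integrable_const _).add ((hc 0 i).comp_fst _))).add ((hcm i).comp_snd _)
    have hcl (i) : Integrable (fun q : Ω × (Fin m → Ω') =>
        A i + c 0 i q.1 + ∑ k : Fin m, l k.succ i (q.2 k)) (P.prod (Measure.pi fun _ => P')) :=
      (((integrable_const _).add ((hc 0 i).comp_fst _))).add ((hlm i).comp_snd _)
    have hll (i) : Integrable (fun q : Ω' × (Fin m → Ω') =>
        A i + l 0 i q.1 + ∑ k : Fin m, l k.succ i (q.2 k)) (P'.prod (Measure.pi fun _ => P')) :=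
      (((integrable_const _).add ((hl 0 i).comp_fst _))).add ((hlm i).comp_snd _)
    have hcF : Integrable (fun ω : Fin (m + 1) → Ω => ⨆ i, (A i + ∑ k, c k i (ω k)))
        (Measure.pi fun _ => P) :=
      integrable_ciSup_of_finite fun i => (integrable_const _).add <| integrable_finsetSum _
        fun k _ => integrable_comp_eval (μ := fun _ : Fin (m + 1) => P) (hc k i)
    have hlF : Integrable (fun ω : Fin (m + 1) → Ω' => ⨆ i, (A i + ∑ k, l k i (ω k)))
        (Measure.pi fun _ => P') :=
      integrable_ciSup_of_finite fun i => (integrable_const _).add <| integrable_finsetSum _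
        fun k _ => integrable_comp_eval (μ := fun _ : Fin (m + 1) => P') (hl k i)
    rw [integral_finCons P hcF, integral_finCons P' hlF]
    simp only [Fin.sum_univ_succ, Fin.cons_zero, Fin.cons_succ, ← add_assoc]
    calc ∫ q : Ω × (Fin m → Ω), ⨆ i, (A i + c 0 i q.1 + ∑ k : Fin m, c k.succ i (q.2 k))
            ∂(P.prod (Measure.pi fun _ => P))
        = ∫ x, ∫ y : Fin m → Ω, ⨆ i, (A i + c 0 i x + ∑ k : Fin m, c k.succ i (y k))
            ∂(Measure.pi fun _ => P) ∂P := integral_prod _ (integrable_ciSup_of_finite hcc)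
      _ ≤ ∫ x, ∫ y : Fin m → Ω', ⨆ i, (A i + c 0 i x + ∑ k : Fin m, l k.succ i (y k))
            ∂(Measure.pi fun _ => P') ∂P :=
          integral_mono (integrable_ciSup_of_finite hcc).integral_prod_left
            (integrable_ciSup_of_finite hcl).integral_prod_left
            fun x => ih (fun k => c k.succ) (fun k => l k.succ) (fun k => hc k.succ)
              (fun k => hl k.succ) (fun k => h k.succ) _
      _ = ∫ y : Fin m → Ω', ∫ x, ⨆ i, (A i + c 0 i x + ∑ k : Fin m, l k.succ i (y k))
            ∂P ∂(Measure.pi fun _ => P') :=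
          integral_integral_swap (integrable_ciSup_of_finite hcl)
      _ ≤ ∫ y : Fin m → Ω', ∫ x, ⨆ i, (A i + l 0 i x + ∑ k : Fin m, l k.succ i (y k))
            ∂P' ∂(Measure.pi fun _ => P') := by
          refine integral_mono (integrable_ciSup_of_finite hcl).integral_prod_right
            (integrable_ciSup_of_finite hll).integral_prod_right fun y => ?_
          simpa only [add_right_comm] using h 0 fun i => A i + ∑ k : Fin m, l k.succ i (y k)
      _ = _ := (integral_prod_symm _ (integrable_ciSup_of_finite hll)).symm

/-- The law of a fair coin flip. -/
def fairCoin : Measure Bool := (PMF.uniformOfFintype Bool).toMeasure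

instance : IsProbabilityMeasure fairCoin := by unfold fairCoin; infer_instance

lemma integral_fairCoin (g : Bool → ℝ) : ∫ b, g b ∂fairCoin = (g true + g false) / 2 := by
  rw [fairCoin, PMF.integral_eq_sum]
  simp
  ring

/-- One-sample symmetrization and contraction for the hinge function: the linear half of the
hinge is kept centred on an independent copy, only its absolute-value half is symmetrized. -/
lemma integral_ciSup_hinge_le {Ω : Type*} [MeasurableSpace Ω] (P : Measure Ω)
    [IsProbabilityMeasure P] (u : ι → Ω → ℝ) (hu : ∀ i, Integrable (u i) P) (A : ι → ℝ) :
    ∫ ω, ⨆ i, (A i + (∫ x, max 0 (1 - u i x) ∂P - max 0 (1 - u i ω))) ∂P ≤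
      ∫ x : Ω × Ω × Bool, ⨆ i, (A i + ((u i x.1 - ∫ y, u i y ∂P) + sgn x.2.2 * u i x.2.1))
        ∂(P.prod (P.prod fairCoin)) := by
  have hmax (t : ℝ) : max 0 (1 - t) = (1 - t) / 2 + |1 - t| / 2 := by
    rcases abs_cases (1 - t) with ⟨h, h'⟩ | ⟨h, h'⟩ <;> rw [h]
    · rw [max_eq_right h']; ring
    · rw [max_eq_left h'.le]; ring
  have h1 (i) : Integrable (fun ω => 1 - u i ω) P := (integrable_const _).sub (hu i)
  have habs (i) : Integrable (fun ω => |1 - u i ω|) P := (h1 i).abs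
  have hE (i) : ∫ x, max 0 (1 - u i x) ∂P =
      (1 - ∫ x, u i x ∂P) / 2 + (∫ x, |1 - u i x| ∂P) / 2 := by
    simp only [hmax]
    rw [integral_add ((h1 i).div_const 2) ((habs i).div_const 2), integral_div, integral_div,
      integral_sub (integrable_const _) (hu i)]
    simp
  have hc (i) : Integrable (fun ω => u i ω - ∫ y, u i y ∂P) P := (hu i).sub (integrable_const _)
  have hmaxint (i) : Integrable (fun ω => max 0 (1 - u i ω)) P := by
    simp only [hmax]; exact ((h1 i).div_const 2).add ((habs i).div_const 2)
  have hplus (i) : Integrable (fun q : Ω × Ω =>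
      A i + (u i q.1 - ∫ y, u i y ∂P) + |1 - u i q.2|) (P.prod P) :=
    ((integrable_const _).add ((hc i).comp_fst _)).add ((habs i).comp_snd _)
  have hminus (i) : Integrable (fun q : Ω × Ω =>
      A i + (u i q.1 - ∫ y, u i y ∂P) - |1 - u i q.2|) (P.prod P) :=
    ((integrable_const _).add ((hc i).comp_fst _)).sub ((habs i).comp_snd _)
  have hplus' (i) : Integrable (fun q : Ω × Ω =>
      A i + (u i q.1 - ∫ y, u i y ∂P) + u i q.2) (P.prod P) :=
    ((integrable_const _).add ((hc i).comp_fst _)).add ((hu i).comp_snd _)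
  have hminus' (i) : Integrable (fun q : Ω × Ω =>
      A i + (u i q.1 - ∫ y, u i y ∂P) - u i q.2) (P.prod P) :=
    ((integrable_const _).add ((hc i).comp_fst _)).sub ((hu i).comp_snd _)
  have hX (i) : Integrable (fun ω =>
      A i + (u i ω - ∫ y, u i y ∂P) + ∫ x, |1 - u i x| ∂P) P :=
    ((integrable_const _).add (hc i)).add (integrable_const _)
  have hY (i) : Integrable (fun ω => A i - |1 - u i ω|) P := (integrable_const _).sub (habs i)
  have hAc (i) : Integrable (fun ω => A i + (u i ω - ∫ y, u i y ∂P)) P :=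
    (integrable_const _).add (hc i)
  have hfirst : ∫ ω, ⨆ i, (A i + (u i ω - ∫ y, u i y ∂P) + ∫ x, |1 - u i x| ∂P) ∂P ≤
      ∫ q : Ω × Ω, ⨆ i, (A i + (u i q.1 - ∫ y, u i y ∂P) + |1 - u i q.2|) ∂(P.prod P) := by
    rw [integral_prod _ (integrable_ciSup_of_finite hplus)]
    refine integral_mono (integrable_ciSup_of_finite hX)
      (integrable_ciSup_of_finite hplus).integral_prod_left fun ω => ?_
    refine le_trans (le_of_eq ?_) (ciSup_integral_le fun i =>
      (integrable_const (A i + (u i ω - ∫ y, u i y ∂P))).add (habs i))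
    refine iSup_congr fun i => ?_
    dsimp only
    rw [integral_add (integrable_const _) (habs i)]
    simp
  have hsecond : ∫ ω, ⨆ i, (A i - |1 - u i ω|) ∂P ≤
      ∫ q : Ω × Ω, ⨆ i, (A i + (u i q.1 - ∫ y, u i y ∂P) - |1 - u i q.2|) ∂(P.prod P) := by
    rw [integral_prod_symm _ (integrable_ciSup_of_finite hminus)]
    refine integral_mono (integrable_ciSup_of_finite hY)
      (integrable_ciSup_of_finite hminus).integral_prod_right fun ω => ?_
    refine le_trans (le_of_eq ?_) (ciSup_integral_le fun i =>
      (hAc i).sub (integrable_const |1 - u i ω|))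
    refine iSup_congr fun i => ?_
    dsimp only
    rw [integral_sub (hAc i) (integrable_const _),
      integral_add (integrable_const _) (hc i), integral_sub (hu i) (integrable_const _)]
    simp
  have hsplit : ∫ ω, ⨆ i, (A i + (∫ x, max 0 (1 - u i x) ∂P - max 0 (1 - u i ω))) ∂P ≤
      ∫ ω, ((⨆ i, (A i + (u i ω - ∫ y, u i y ∂P) + ∫ x, |1 - u i x| ∂P)) +
        ⨆ i, (A i - |1 - u i ω|)) / 2 ∂P := by
    refine integral_mono (integrable_ciSup_of_finite fun i => (integrable_const _).add
      ((integrable_const _).sub (hmaxint i))) (((integrable_ciSup_of_finite hX).add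
      (integrable_ciSup_of_finite hY)).div_const 2) fun ω => ciSup_le fun i => ?_
    have e1 := le_ciSup_of_finite
      (fun i => A i + (u i ω - ∫ y, u i y ∂P) + ∫ x, |1 - u i x| ∂P) i
    have e2 := le_ciSup_of_finite (fun i => A i - |1 - u i ω|) i
    rw [hE, hmax]
    dsimp only at *
    linarith
  have hlint (i) : Integrable (fun x : Ω × Ω × Bool =>
      A i + ((u i x.1 - ∫ y, u i y ∂P) + sgn x.2.2 * u i x.2.1)) (P.prod (P.prod fairCoin)) := by
    refine (integrable_const _).add (((hc i).comp_fst _).add ?_)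
    have : Integrable (fun q : Ω × Bool => sgn q.2 * u i q.1) (P.prod fairCoin) := by
      have := (hu i).mul_prod (Integrable.of_finite (f := sgn) (μ := fairCoin))
      simpa only [mul_comm] using this
    exact this.comp_snd P
  have hpair (ω : Ω) : Integrable (fun q : Ω × Bool =>
      ⨆ i, (A i + ((u i ω - ∫ y, u i y ∂P) + sgn q.2 * u i q.1))) (P.prod fairCoin) := by
    refine integrable_ciSup_of_finite fun i => (integrable_const _).add ((integrable_const _).add ?_)
    have := (hu i).mul_prod (Integrable.of_finite (f := sgn) (μ := fairCoin))
    simpa only [mul_comm] using this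
  have hhalf : Integrable (fun q : Ω × Ω =>
      ((⨆ i, (A i + (u i q.1 - ∫ y, u i y ∂P) + u i q.2)) +
        ⨆ i, (A i + (u i q.1 - ∫ y, u i y ∂P) - u i q.2)) / 2) (P.prod P) :=
    ((integrable_ciSup_of_finite hplus').add (integrable_ciSup_of_finite hminus')).div_const 2
  have hright : ∫ x : Ω × Ω × Bool,
        ⨆ i, (A i + ((u i x.1 - ∫ y, u i y ∂P) + sgn x.2.2 * u i x.2.1))
        ∂(P.prod (P.prod fairCoin)) =
      ∫ q : Ω × Ω, ((⨆ i, (A i + (u i q.1 - ∫ y, u i y ∂P) + u i q.2)) +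
        ⨆ i, (A i + (u i q.1 - ∫ y, u i y ∂P) - u i q.2)) / 2 ∂(P.prod P) := by
    rw [integral_prod _ (integrable_ciSup_of_finite hlint), integral_prod _ hhalf]
    refine integral_congr_ae (Filter.Eventually.of_forall fun ω => ?_)
    dsimp only
    rw [integral_prod _ (hpair ω)]
    refine integral_congr_ae (Filter.Eventually.of_forall fun x => ?_)
    dsimp only
    rw [integral_fairCoin]
    simp [sgn, add_assoc, sub_eq_add_neg]
  rw [hright]
  refine hsplit.trans ?_
  rw [integral_div, integral_div, integral_add (integrable_ciSup_of_finite hX)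
    (integrable_ciSup_of_finite hY)]
  refine div_le_div_of_nonneg_right ((add_le_add hfirst hsecond).trans ?_) zero_le_two
  rw [← integral_add (integrable_ciSup_of_finite hplus) (integrable_ciSup_of_finite hminus)]
  exact integral_mono ((integrable_ciSup_of_finite hplus).add (integrable_ciSup_of_finite hminus))
    ((integrable_ciSup_of_finite hplus').add (integrable_ciSup_of_finite hminus'))
    fun q => ciSup_add_abs_add_ciSup_sub_abs_le _ _

end Contraction

section Concentration

open ProbabilityTheory
open scoped NNReal

lemma integrable_of_measurable_of_mem_Icc {Ω : Type*} [MeasurableSpace Ω] {P : Measure Ω}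
    [IsFiniteMeasure P] {F : Ω → ℝ} (hF : Measurable F) {a b : ℝ} (hab : ∀ x, F x ∈ Set.Icc a b) :
    Integrable F P :=
  Integrable.of_mem_Icc a b hF.aemeasurable (Filter.Eventually.of_forall hab)

/-- Hoeffding's lemma for a function of oscillation at most `c`. -/
lemma integral_exp_mul_sub_integral_le {Z : Type*} [MeasurableSpace Z] (D : Measure Z)
    [IsProbabilityMeasure D] {h : Z → ℝ} (hm : Measurable h) {c : ℝ≥0}
    (hc : ∀ z z', h z - h z' ≤ c) (t : ℝ) :
    ∫ z, Real.exp (t * (h z - ∫ z, h z ∂D)) ∂D ≤ Real.exp ((c / 2 : ℝ) ^ 2 * t ^ 2 / 2) := by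
  have : Nonempty Z := D.nonempty_of_neZero
  obtain ⟨z₀⟩ := this
  have hbdd : BddBelow (Set.range h) := ⟨h z₀ - c, by rintro _ ⟨z, rfl⟩; linarith [hc z₀ z]⟩
  have hmem (z) : h z ∈ Set.Icc (⨅ z, h z) ((⨅ z, h z) + c) := by
    refine ⟨ciInf_le hbdd z, ?_⟩
    have : Nonempty Z := ⟨z₀⟩
    have : h z - c ≤ ⨅ z, h z := le_ciInf fun z' => by linarith [hc z z']
    linarith
  have h := (hasSubgaussianMGF_of_mem_Icc (μ := D) hm.aemeasurable
    (Filter.Eventually.of_forall hmem)).mgf_le t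
  simpa [mgf] using h

/-- The exponential moment bound behind McDiarmid's bounded differences inequality. -/
lemma integral_exp_mul_sub_integral_le_of_bounded_differences {Z : Type*} [MeasurableSpace Z]
    (D : Measure Z) [IsProbabilityMeasure D] {n : ℕ} {F : (Fin n → Z) → ℝ} (hF : Measurable F)
    {a b : ℝ} (hab : ∀ x, F x ∈ Set.Icc a b) {c : ℝ≥0}
    (hc : ∀ x i z, F (Function.update x i z) - F x ≤ c) (t : ℝ) :
    ∫ x, Real.exp (t * (F x - ∫ x, F x ∂(Measure.pi fun _ => D))) ∂(Measure.pi fun _ => D) ≤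
      Real.exp (n * (c / 2 : ℝ) ^ 2 * t ^ 2 / 2) := by
  induction n with
  | zero =>
    have hconst (x : Fin 0 → Z) : F x = F default := congrArg F (Subsingleton.elim _ _)
    simp [hconst]
  | succ n ih =>
    have hFi : Integrable F (Measure.pi fun _ => D) := integrable_of_measurable_of_mem_Icc hF hab
    have hcons : Measurable fun q : Z × (Fin n → Z) => (Fin.cons q.1 q.2 : Fin (n + 1) → Z) :=
      (measurePreserving_finCons D).measurable
    have hsec (y : Fin n → Z) : Measurable fun z : Z => F (Fin.cons z y) :=
      hF.comp (hcons.comp (measurable_id.prodMk measurable_const))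
    have hseci (y : Fin n → Z) : Integrable (fun z : Z => F (Fin.cons z y)) D :=
      integrable_of_measurable_of_mem_Icc (hsec y) fun z => hab _
    set G : (Fin n → Z) → ℝ := fun y => ∫ z, F (Fin.cons z y) ∂D with hGdef
    have hG : Measurable G :=
      (hF.comp hcons).stronglyMeasurable.integral_prod_left'.measurable
    have hGab (y) : G y ∈ Set.Icc a b := by
      constructor
      · simpa using integral_mono (μ := D) (integrable_const a) (hseci y) fun z => (hab _).1
      · simpa using integral_mono (μ := D) (hseci y) (integrable_const b) fun z => (hab _).2
    have hGc (y : Fin n → Z) (i z) : G (Function.update y i z) - G y ≤ c := by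
      rw [hGdef, ← integral_sub (hseci _) (hseci _)]
      refine (integral_mono (μ := D) ((hseci _).sub (hseci _)) (integrable_const (c : ℝ))
        fun w => ?_).trans (by simp)
      have := hc (Fin.cons w y) i.succ z
      rwa [← Fin.cons_update] at this
    have hFG : ∫ x, F x ∂(Measure.pi fun _ => D) = ∫ y, G y ∂(Measure.pi fun _ => D) := by
      rw [integral_finCons D hFi, integral_prod_symm _ (integrable_finCons D hFi)]
    set e := ∫ y, G y ∂(Measure.pi fun _ => D)
    have hbd (s : ℝ) (hs : s ∈ Set.Icc a b) :
        Real.exp (t * (s - e)) ∈ Set.Icc 0 (Real.exp (|t| * (|a| + |b| + |e|))) := by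
      refine ⟨(Real.exp_pos _).le, Real.exp_le_exp.2 ?_⟩
      refine (le_abs_self _).trans ?_
      rw [abs_mul]
      refine mul_le_mul_of_nonneg_left ?_ (abs_nonneg _)
      refine abs_le.2 ⟨?_, ?_⟩ <;>
      linarith [neg_abs_le a, le_abs_self b, neg_abs_le e, le_abs_self e, hs.1, hs.2,
        abs_nonneg a, abs_nonneg b]
    have hexp : Integrable (fun x => Real.exp (t * (F x - e))) (Measure.pi fun _ => D) :=
      integrable_of_measurable_of_mem_Icc (by fun_prop) fun x => hbd _ (hab x)
    have hexpG : Integrable (fun y => Real.exp (t * (G y - e))) (Measure.pi fun _ => D) :=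
      integrable_of_measurable_of_mem_Icc (by fun_prop) fun x => hbd _ (hGab x)
    rw [hFG, integral_finCons D hexp, integral_prod_symm _ (integrable_finCons D hexp)]
    calc ∫ y : Fin n → Z, ∫ z, Real.exp (t * (F (Fin.cons z y) - e)) ∂D ∂(Measure.pi fun _ => D)
        ≤ ∫ y, Real.exp (t * (G y - e)) * Real.exp ((c / 2 : ℝ) ^ 2 * t ^ 2 / 2)
            ∂(Measure.pi fun _ => D) := by
          refine integral_mono (integrable_finCons D hexp).integral_prod_right
            (hexpG.mul_const _) fun y => ?_
          have hy : ∫ z, Real.exp (t * (F (Fin.cons z y) - e)) ∂D =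
              Real.exp (t * (G y - e)) * ∫ z, Real.exp (t * (F (Fin.cons z y) - G y)) ∂D := by
            rw [← integral_const_mul]
            refine integral_congr_ae (Filter.Eventually.of_forall fun z => ?_)
            dsimp only
            rw [← Real.exp_add]
            ring_nf
          dsimp only
          rw [hy]
          refine mul_le_mul_of_nonneg_left ?_ (Real.exp_pos _).le
          refine integral_exp_mul_sub_integral_le D (hsec y) (fun z z' => ?_) t
          have := hc (Fin.cons z' y) 0 z
          rwa [Fin.update_cons_zero] at this
      _ ≤ Real.exp (n * (c / 2 : ℝ) ^ 2 * t ^ 2 / 2) * Real.exp ((c / 2 : ℝ) ^ 2 * t ^ 2 / 2) := by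
          rw [integral_mul_const]
          exact mul_le_mul_of_nonneg_right (ih hG hGab hGc) (Real.exp_pos _).le
      _ = _ := by
          rw [← Real.exp_add]
          push_cast
          ring_nf

/-- McDiarmid's inequality: a function with bounded differences is sub-Gaussian about its mean. -/
lemma hasSubgaussianMGF_of_bounded_differences {Z : Type*} [MeasurableSpace Z]
    (D : Measure Z) [IsProbabilityMeasure D] {n : ℕ} {F : (Fin n → Z) → ℝ} (hF : Measurable F)
    {a b : ℝ} (hab : ∀ x, F x ∈ Set.Icc a b) {c : ℝ≥0}
    (hc : ∀ x i z, F (Function.update x i z) - F x ≤ c) :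
    HasSubgaussianMGF (fun x => F x - ∫ x, F x ∂(Measure.pi fun _ => D)) (n * (c / 2) ^ 2)
      (Measure.pi fun _ => D) where
  integrable_exp_mul t := by
    refine integrable_exp_mul_of_mem_Icc (a := a - ∫ x, F x ∂(Measure.pi fun _ => D))
      (b := b - ∫ x, F x ∂(Measure.pi fun _ => D)) (hF.sub_const _).aemeasurable ?_
    exact Filter.Eventually.of_forall fun x =>
      ⟨sub_le_sub_right (hab x).1 _, sub_le_sub_right (hab x).2 _⟩
  mgf_le t := by
    simpa [mgf] using integral_exp_mul_sub_integral_le_of_bounded_differences D hF hab hc t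

/-- Maximal inequality: the positive part of the maximum of at least three centred sub-Gaussian
variables obeys the same bound as their maximum. -/
lemma integral_ciSup_max_zero_le {Ω : Type*} [MeasurableSpace Ω] {P : Measure Ω}
    [IsProbabilityMeasure P] {p : ℕ} (hp : 3 ≤ p) {Z : Fin p → Ω → ℝ} {V : ℝ≥0} (hV : 0 < V)
    (hZ : ∀ j, HasSubgaussianMGF (Z j) V P) (hmean : ∀ j, ∫ ω, Z j ω ∂P = 0) :
    ∫ ω, ⨆ j, max 0 (Z j ω) ∂P ≤ √(2 * V * Real.log p) := by
  have : Nonempty (Fin p) := ⟨⟨0, by omega⟩⟩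
  have hp' : (3 : ℝ) ≤ p := by exact_mod_cast hp
  have hp0 : (0 : ℝ) < p := by linarith
  have hV' : (0 : ℝ) < V := hV
  have hL : 0 < Real.log p := Real.log_pos (by linarith)
  have he1 := Real.exp_one_gt_d9
  have he2 := Real.exp_one_lt_d9
  have he0 := Real.exp_pos 1
  have hi : Real.exp (-1) * Real.exp 1 = 1 := by rw [← Real.exp_add]; simp
  have hi0 := Real.exp_pos (-1)
  set q := Real.exp (-1)
  have hq : q * 2 ≤ 1 := by nlinarith
  have hLp : 2 * Real.log p ≤ p := by
    have := Real.log_le_sub_one_of_pos (mul_pos hi0 hp0)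
    rw [Real.log_mul hi0.ne' hp0.ne', Real.log_exp] at this
    nlinarith
  set t := √(2 * Real.log p / V) with ht
  have htt : t ^ 2 * V = 2 * Real.log p := by
    rw [ht, Real.sq_sqrt (by positivity)]
    field_simp
  have ht0 : 0 < t := Real.sqrt_pos.2 (by positivity)
  have hZi (j) : Integrable (Z j) P := (hZ j).integrable
  set y : Ω → ℝ := fun ω => ⨆ j, max 0 (Z j ω) with hy
  have hyi : Integrable y P := integrable_ciSup_of_finite fun j =>
    (integrable_zero _ _ _).sup (hZi j)
  set x := t * ∫ ω, y ω ∂P with hx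
  have hφ (u : ℝ) : 0 ≤ Real.exp u - q * (u + 2) := by
    have h1 := Real.add_one_le_exp (u + 1)
    have h2 : Real.exp u = q * Real.exp (u + 1) := by
      rw [← Real.exp_add]; ring_nf
    rw [h2]
    nlinarith
  have hexp (j) : Integrable (fun ω => Real.exp (t * Z j ω)) P := (hZ j).integrable_exp_mul t
  have hpt (ω) : Real.exp x * (1 + t * y ω - x) ≤
      1 + q * (t * y ω) + ∑ j, (Real.exp (t * Z j ω) - q * (t * Z j ω + 2)) := by
    have h1 : Real.exp x * (1 + t * y ω - x) ≤ Real.exp (t * y ω) := by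
      have := Real.add_one_le_exp (t * y ω - x)
      have h3 : Real.exp (t * y ω) = Real.exp x * Real.exp (t * y ω - x) := by
        rw [← Real.exp_add]; ring_nf
      rw [h3]
      exact mul_le_mul_of_nonneg_left (by linarith) (Real.exp_pos _).le
    refine h1.trans ?_
    obtain ⟨j, hj⟩ := exists_eq_ciSup_of_finite (f := fun j => max 0 (Z j ω))
    have hsum := Finset.single_le_sum
      (f := fun j => Real.exp (t * Z j ω) - q * (t * Z j ω + 2)) (fun i _ => hφ (t * Z i ω))
      (Finset.mem_univ j)
    have hyj : y ω = max 0 (Z j ω) := hj.symm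
    rcases le_total 0 (Z j ω) with h | h
    · rw [hyj, max_eq_right h]
      linarith
    · rw [hyj, max_eq_left h]
      have h0 := (hφ (t * Z j ω)).trans hsum
      simp only [mul_zero, Real.exp_zero]
      linarith
  have hlin : Integrable (fun ω => Real.exp x * (1 + t * y ω - x)) P :=
    (((integrable_const _).add (hyi.const_mul t)).sub (integrable_const _)).const_mul _
  have hqz (j) : Integrable (fun ω => q * (t * Z j ω + 2)) P :=
    (((hZi j).const_mul t).add (integrable_const _)).const_mul _
  have hφi (j) : Integrable (fun ω => Real.exp (t * Z j ω) - q * (t * Z j ω + 2)) P :=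
    (hexp j).sub (hqz j)
  have hqy : Integrable (fun ω => 1 + q * (t * y ω)) P :=
    (integrable_const _).add ((hyi.const_mul t).const_mul q)
  have hsumi : Integrable (fun ω => ∑ j, (Real.exp (t * Z j ω) - q * (t * Z j ω + 2))) P :=
    integrable_finsetSum _ fun j _ => hφi j
  have hmain := integral_mono hlin (hqy.add hsumi) hpt
  have hty : Integrable (fun ω => 1 + t * y ω) P := (integrable_const _).add (hyi.const_mul t)
  have hleft : ∫ ω, Real.exp x * (1 + t * y ω - x) ∂P = Real.exp x := by
    rw [integral_const_mul, integral_sub hty (integrable_const _),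
      integral_add (integrable_const _) (hyi.const_mul t), integral_const_mul, ← hx]
    simp
  have hmgf (j) : ∫ ω, (Real.exp (t * Z j ω) - q * (t * Z j ω + 2)) ∂P ≤ p - q * 2 := by
    rw [integral_sub (hexp j) (hqz j), integral_const_mul,
      integral_add ((hZi j).const_mul t) (integrable_const _), integral_const_mul, hmean]
    have := (hZ j).mgf_le t
    rw [show (V : ℝ) * t ^ 2 / 2 = Real.log p by linarith, Real.exp_log hp0] at this
    simp only [mgf] at this
    simp
    linarith
  have hright : Real.exp x ≤ 1 + q * x + p * (p - q * 2) := by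
    rw [hleft] at hmain
    refine hmain.trans ?_
    have e1 : ∫ ω, ((fun ω => 1 + q * (t * y ω)) +
        fun ω => ∑ j, (Real.exp (t * Z j ω) - q * (t * Z j ω + 2))) ω ∂P =
        (1 + q * x) + ∑ j, ∫ ω, (Real.exp (t * Z j ω) - q * (t * Z j ω + 2)) ∂P := by
      simp only [Pi.add_apply]
      rw [integral_add hqy hsumi, integral_add (integrable_const _)
        ((hyi.const_mul t).const_mul q), integral_const_mul, integral_const_mul,
        integral_finsetSum _ fun j _ => hφi j]
      simp [hx]
    rw [e1]
    have := Finset.sum_le_sum fun j (_ : j ∈ Finset.univ) => hmgf j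
    simp only [Finset.sum_const, Finset.card_univ, Fintype.card_fin, nsmul_eq_mul] at this
    linarith
  have hx2 : x ≤ 2 * Real.log p := by
    by_contra! hlt
    have h1 : (p : ℝ) ^ 2 * (1 + (x - 2 * Real.log p)) ≤ Real.exp x := by
      have h2 : Real.exp x = (p : ℝ) ^ 2 * Real.exp (x - 2 * Real.log p) := by
        rw [Real.exp_sub, two_mul, Real.exp_add, Real.exp_log hp0]
        field_simp
      rw [h2]
      exact mul_le_mul_of_nonneg_left (by linarith [Real.add_one_le_exp (x - 2 * Real.log p)])
        (by positivity)
    have h3 : 1 ≤ q * (2 * p - 2 * Real.log p) := by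
      rw [← hi]
      exact mul_le_mul_of_nonneg_left (by linarith) hi0.le
    have h4 : 0 < ((p : ℝ) ^ 2 - q) * (x - 2 * Real.log p) :=
      mul_pos (by nlinarith) (by linarith)
    nlinarith
  rw [← mul_le_mul_iff_right₀ ht0]
  refine hx2.trans (le_of_eq ?_)
  rw [ht, ← Real.sqrt_mul (by positivity)]
  rw [show 2 * Real.log p / V * (2 * V * Real.log p) = (2 * Real.log p) ^ 2 by
    field_simp]
  rw [Real.sqrt_sq (by positivity)]

end Concentration

section Symmetrized

open ProbabilityTheory
open scoped NNReal

variable {Ω : Type*} [MeasurableSpace Ω] (P : Measure Ω)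

lemma abs_sgn (b : Bool) : |sgn b| = 1 := by cases b <;> simp [sgn]

lemma measurable_sgn : Measurable sgn := measurable_of_finite _

/-- A centred copy of `v` plus an independent randomly signed copy of `v`. -/
def symmetrized (v : Ω → ℝ) (x : Ω × Ω × Bool) : ℝ :=
  (v x.1 - ∫ y, v y ∂P) + sgn x.2.2 * v x.2.1

lemma measurable_symmetrized {v : Ω → ℝ} (hv : Measurable v) : Measurable (symmetrized P v) :=
  ((hv.comp measurable_fst).sub_const _).add
    ((measurable_sgn.comp measurable_snd.snd).mul (hv.comp measurable_snd.fst))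

variable [IsProbabilityMeasure P]

lemma integral_sgn_mul (v : Ω → ℝ) :
    ∫ x : Ω × Bool, sgn x.2 * v x.1 ∂(P.prod fairCoin) = 0 := by
  have : ∫ b, sgn b ∂fairCoin = 0 := by rw [integral_fairCoin]; simp [sgn]
  simp_rw [mul_comm (sgn _)]
  rw [integral_prod_mul v sgn, this, mul_zero]

lemma hasSubgaussianMGF_symmetrized {v : Ω → ℝ} (hv : Measurable v) {M : ℝ≥0}
    (hM : ∀ x, |v x| ≤ M) :
    HasSubgaussianMGF (symmetrized P v) (M ^ 2 + M ^ 2) (P.prod (P.prod fairCoin)) := by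
  have hparam : (‖(M : ℝ) - -M‖₊ / 2) ^ 2 = M ^ 2 := by
    rw [show (M : ℝ) - -M = 2 * M by ring, nnnorm_mul]
    ext
    simp
  have h1 : HasSubgaussianMGF (fun x => v x - ∫ y, v y ∂P) (M ^ 2) P := by
    rw [← hparam]
    exact hasSubgaussianMGF_of_mem_Icc hv.aemeasurable
      (Filter.Eventually.of_forall fun x => abs_le.1 (hM x))
  have hm2 : Measurable fun x : Ω × Bool => sgn x.2 * v x.1 :=
    (measurable_sgn.comp measurable_snd).mul (hv.comp measurable_fst)
  have h2 : HasSubgaussianMGF (fun x : Ω × Bool => sgn x.2 * v x.1) (M ^ 2) (P.prod fairCoin) := by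
    rw [← hparam]
    refine hasSubgaussianMGF_of_mem_Icc_of_integral_eq_zero hm2.aemeasurable
      (Filter.Eventually.of_forall fun x => abs_le.1 ?_) (integral_sgn_mul P v)
    rw [abs_mul, abs_sgn, one_mul]
    exact hM _
  refine HasSubgaussianMGF.add_of_indepFun (X := fun x : Ω × Ω × Bool => v x.1 - ∫ y, v y ∂P)
    (Y := fun x : Ω × Ω × Bool => sgn x.2.2 * v x.2.1) ?_ ?_
    (indepFun_prod (hv.sub_const _) hm2)
  · exact HasSubgaussianMGF.of_map (Y := Prod.fst) measurable_fst.aemeasurable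
      (X := fun x => v x - ∫ y, v y ∂P) (by rwa [measurePreserving_fst.map_eq])
  · exact HasSubgaussianMGF.of_map (Y := Prod.snd) measurable_snd.aemeasurable
      (X := fun x : Ω × Bool => sgn x.2 * v x.1) (by rwa [measurePreserving_snd.map_eq])

lemma integral_symmetrized {v : Ω → ℝ} (hv : Integrable v P) :
    ∫ x, symmetrized P v x ∂(P.prod (P.prod fairCoin)) = 0 := by
  have h2 : Integrable (fun x : Ω × Bool => sgn x.2 * v x.1) (P.prod fairCoin) := by
    have := hv.mul_prod (Integrable.of_finite (f := sgn) (μ := fairCoin))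
    simpa only [mul_comm] using this
  have h1 : Integrable (fun x => v x - ∫ y, v y ∂P) P := hv.sub (integrable_const _)
  unfold symmetrized
  rw [integral_add (h1.comp_fst _) (h2.comp_snd _), integral_fun_fst (fun x => v x - ∫ y, v y ∂P),
    integral_fun_snd (fun x : Ω × Bool => sgn x.2 * v x.1), integral_sgn_mul,
    integral_sub hv (integrable_const _)]
  simp

lemma ip_le_mul_ciSup {p : ℕ} [Nonempty (Fin p)] {θ : Fin p → ℝ} (hθ : ∀ j, 0 ≤ θ j) {W : ℝ}
    (hW : l1norm θ ≤ W) (z : Fin p → ℝ) : ip θ z ≤ W * ⨆ j, max 0 (z j) := by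
  have h0 : 0 ≤ ⨆ j, max 0 (z j) := Real.iSup_nonneg fun j => le_max_left _ _
  calc ip θ z ≤ ∑ j, θ j * ⨆ j, max 0 (z j) := Finset.sum_le_sum fun j _ =>
        mul_le_mul_of_nonneg_left
          ((le_max_right 0 _).trans (le_ciSup_of_finite (fun j => max 0 (z j)) j)) (hθ j)
    _ = l1norm θ * ⨆ j, max 0 (z j) := by
        rw [l1norm, Finset.sum_mul]
        exact Finset.sum_congr rfl fun j _ => by rw [abs_of_nonneg (hθ j)]
    _ ≤ _ := mul_le_mul_of_nonneg_right hW h0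

/-- Expected uniform deviation of independent hinge losses over an `ℓ₁`-ball. -/
lemma integral_ciSup_sum_hinge_le {ι : Type*} [Finite ι] [Nonempty ι] {p m : ℕ} (hp : 3 ≤ p)
    (hm : 0 < m) (v : Fin m → Ω → Fin p → ℝ) (hv : ∀ k j, Measurable fun ω => v k ω j)
    {M : ℝ≥0} (hM0 : 0 < M) (hM : ∀ k ω j, |v k ω j| ≤ M) (θ : ι → Fin p → ℝ)
    (hθ : ∀ i j, 0 ≤ θ i j) {W : ℝ} (hW0 : 0 ≤ W) (hW : ∀ i, l1norm (θ i) ≤ W) :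
    ∫ ω, ⨆ i, ∑ k, (∫ x, max 0 (1 - ip (θ i) (v k x)) ∂P - max 0 (1 - ip (θ i) (v k (ω k))))
        ∂(Measure.pi fun _ : Fin m => P) ≤
      W * √(2 * (m * (M ^ 2 + M ^ 2)) * Real.log p) := by
  have : Nonempty (Fin p) := ⟨⟨0, by omega⟩⟩
  have hvi (k j) : Integrable (fun ω => v k ω j) P :=
    integrable_of_measurable_of_mem_Icc (hv k j) fun ω => abs_le.1 (hM k ω j)
  have hu (k i) : Integrable (fun ω => ip (θ i) (v k ω)) P :=
    integrable_finsetSum _ fun j _ => (hvi k j).const_mul _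
  have hmaxi (k i) : Integrable (fun ω => max 0 (1 - ip (θ i) (v k ω))) P :=
    (integrable_zero _ _ _).sup ((integrable_const _).sub (hu k i))
  set P' := P.prod (P.prod fairCoin)
  have hsub (k j) : HasSubgaussianMGF (symmetrized P fun ω => v k ω j) (M ^ 2 + M ^ 2) P' :=
    hasSubgaussianMGF_symmetrized P (hv k j) fun ω => hM k ω j
  have hlin (k i) (x : Ω × Ω × Bool) :
      (ip (θ i) (v k x.1) - ∫ y, ip (θ i) (v k y) ∂P) + sgn x.2.2 * ip (θ i) (v k x.2.1) =
        ip (θ i) (fun j => symmetrized P (fun ω => v k ω j) x) := by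
    have : ∫ y, ip (θ i) (v k y) ∂P = ∑ j, θ i j * ∫ y, v k y j ∂P := by
      unfold ip
      rw [integral_finsetSum _ fun j _ => (hvi k j).const_mul _]
      simp_rw [integral_const_mul]
    rw [this]
    unfold ip symmetrized
    rw [Finset.mul_sum, ← Finset.sum_sub_distrib, ← Finset.sum_add_distrib]
    exact Finset.sum_congr rfl fun j _ => by ring
  have hli (k i) : Integrable (fun x => ip (θ i) (fun j => symmetrized P (fun ω => v k ω j) x))
      P' := integrable_finsetSum _ fun j _ => (hsub k j).integrable.const_mul _
  have hcontr := integral_ciSup_sum_le P P' m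
    (fun k i ω => ∫ x, max 0 (1 - ip (θ i) (v k x)) ∂P - max 0 (1 - ip (θ i) (v k ω)))
    (fun k i x => ip (θ i) (fun j => symmetrized P (fun ω => v k ω j) x))
    (fun k i => (integrable_const _).sub (hmaxi k i)) hli
    (fun k A => by
      have := integral_ciSup_hinge_le P (fun i ω => ip (θ i) (v k ω)) (hu k) A
      simpa only [hlin] using this) 0
  simp only [Pi.zero_apply, zero_add] at hcontr
  refine hcontr.trans ?_
  set Z : Fin p → (Fin m → Ω × Ω × Bool) → ℝ :=
    fun j x => ∑ k, symmetrized P (fun ω => v k ω j) (x k) with hZdef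
  have hZ (j) : HasSubgaussianMGF (Z j) (m * (M ^ 2 + M ^ 2)) (Measure.pi fun _ => P') := by
    have hind := iIndepFun_pi (μ := fun _ : Fin m => P')
      (X := fun k => symmetrized P fun ω => v k ω j)
      fun k => (measurable_symmetrized P (hv k j)).aemeasurable
    have := HasSubgaussianMGF.sum_of_iIndepFun hind (c := fun _ => M ^ 2 + M ^ 2)
      (s := Finset.univ) fun k _ => HasSubgaussianMGF.of_map (Y := Function.eval k)
        (X := symmetrized P fun ω => v k ω j) (measurable_pi_apply k).aemeasurable
        (by rw [(measurePreserving_eval (fun _ : Fin m => P') k).map_eq]; exact hsub k j)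
    rwa [Finset.sum_const, Finset.card_univ, nsmul_eq_mul, Fintype.card_fin] at this
  have hmean (j) : ∫ x, Z j x ∂(Measure.pi fun _ => P') = 0 := by
    simp only [hZdef]
    rw [integral_finsetSum _ fun k _ =>
      integrable_comp_eval (μ := fun _ : Fin m => P') (hsub k j).integrable]
    refine Finset.sum_eq_zero fun k _ => ?_
    rw [integral_comp_eval (μ := fun _ : Fin m => P')
      (measurable_symmetrized P (hv k j)).aestronglyMeasurable]
    exact integral_symmetrized P (hvi k j)
  have hmax := integral_ciSup_max_zero_le hp (V := m * (M ^ 2 + M ^ 2)) (by positivity) hZ hmean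
  have hZi : Integrable (fun x => ⨆ j, max 0 (Z j x)) (Measure.pi fun _ => P') :=
    integrable_ciSup_of_finite fun j => (integrable_zero _ _ _).sup (hZ j).integrable
  calc _ ≤ ∫ x, W * ⨆ j, max 0 (Z j x) ∂(Measure.pi fun _ => P') := by
        refine integral_mono (integrable_ciSup_of_finite fun i => integrable_finsetSum _ fun k _ =>
          integrable_comp_eval (μ := fun _ : Fin m => P') (hli k i)) (hZi.const_mul W)
          fun x => ciSup_le fun i => ?_
        refine le_trans (le_of_eq ?_) (ip_le_mul_ciSup (hθ i) (hW i) fun j => Z j x)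
        simp only [ip, hZdef, Finset.mul_sum]
        exact Finset.sum_comm
    _ = W * ∫ x, ⨆ j, max 0 (Z j x) ∂(Measure.pi fun _ => P') := integral_const_mul _ _
    _ ≤ _ := mul_le_mul_of_nonneg_left (by simpa using hmax) hW0

end Symmetrized

section PermutationAverage

variable {α : Type*} [Fintype α] [DecidableEq α]

lemma sum_perm_apply_apply_eq (H : α → α → ℝ) {a b a' b' : α} (hab : a ≠ b) (hab' : a' ≠ b') :
    ∑ σ : Equiv.Perm α, H (σ a) (σ b) = ∑ σ : Equiv.Perm α, H (σ a') (σ b') := by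
  have hne : Equiv.swap a' a b' ≠ a := fun h =>
    hab' (by simpa using ((Equiv.swap a' a).injective (h.trans (Equiv.swap_apply_left a' a).symm)).symm)
  set τ : Equiv.Perm α := Equiv.swap (Equiv.swap a' a b') b * Equiv.swap a' a
  have ha : τ a' = a := by
    simp [τ, Equiv.swap_apply_of_ne_of_ne hne.symm hab]
  have hb : τ b' = b := by simp [τ]
  rw [← Equiv.sum_comp (Equiv.mulRight τ) fun σ => H (σ a') (σ b')]
  simp [ha, hb]

/-- Averaging a function of two distinct points over all permutations averages it over all
ordered pairs of distinct points. -/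
lemma card_mul_sum_perm_apply_apply (H : α → α → ℝ) {a b : α} (hab : a ≠ b) :
    (Fintype.card α : ℝ) * (Fintype.card α - 1) * ∑ σ : Equiv.Perm α, H (σ a) (σ b) =
      (Fintype.card α).factorial * ∑ i, ∑ j, if i ≠ j then H i j else 0 := by
  have h1 : ∑ i, ∑ j, ∑ σ : Equiv.Perm α, (if i ≠ j then H (σ i) (σ j) else 0) =
      (Fintype.card α : ℝ) * (Fintype.card α - 1) * ∑ σ : Equiv.Perm α, H (σ a) (σ b) := by
    have h (i j : α) : ∑ σ : Equiv.Perm α, (if i ≠ j then H (σ i) (σ j) else 0) =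
        (1 - if i = j then 1 else 0) * ∑ σ : Equiv.Perm α, H (σ a) (σ b) := by
      by_cases hij : i = j
      · simp [hij]
      · simp [hij, sum_perm_apply_apply_eq H hij hab]
    simp_rw [h, ← Finset.sum_mul]
    simp [mul_sub_one]
  have h2 (σ : Equiv.Perm α) : ∑ i, ∑ j, (if i ≠ j then H (σ i) (σ j) else 0) =
      ∑ i, ∑ j, if i ≠ j then H i j else 0 := by
    rw [← Equiv.sum_comp σ fun i => ∑ j, if i ≠ j then H i j else 0]
    refine Finset.sum_congr rfl fun i _ => ?_
    rw [← Equiv.sum_comp σ fun j => if σ i ≠ j then H (σ i) j else 0]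
    simp
  rw [← h1]
  calc _ = ∑ i, ∑ σ : Equiv.Perm α, ∑ j, (if i ≠ j then H (σ i) (σ j) else 0) :=
        Finset.sum_congr rfl fun i _ => Finset.sum_comm
    _ = ∑ σ : Equiv.Perm α, ∑ i, ∑ j, (if i ≠ j then H (σ i) (σ j) else 0) := Finset.sum_comm
    _ = _ := by
        simp_rw [h2]
        simp [Fintype.card_perm]

end PermutationAverage

section PairedLaw

variable {Z : Type*} [MeasurableSpace Z] (D : Measure Z) [IsProbabilityMeasure D]

/-- Disjoint pairs of coordinates of an i.i.d. sample are i.i.d. -/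
lemma measurePreserving_pairs {κ ν : Type*} [Fintype κ] [Fintype ν] (e : κ ⊕ κ ≃ ν) :
    MeasurePreserving (fun (S : ν → Z) k => (S (e (Sum.inl k)), S (e (Sum.inr k))))
      (Measure.pi fun _ => D) (Measure.pi fun _ : κ => D.prod D) := by
  have h1 := (measurePreserving_piCongrLeft (fun _ : ν => D) e).symm
  have h2 := measurePreserving_sumPiEquivProdPi (fun _ : κ ⊕ κ => D)
  have h3 := (measurePreserving_arrowProdEquivProdArrow Z Z κ (fun _ => D) fun _ => D).symm
  exact h3.comp (h2.comp h1)

end PairedLaw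

section Hinge

variable {X : Type*} {p n : ℕ} (K : Fin p → X → X → ℝ)

/-- The hinge loss of the unordered pair `{i, j}` of sample points. -/
def pairHinge (S : Fin n → X × Bool) (μ : Fin p → ℝ) (i j : Fin n) : ℝ :=
  if i < j then hinge K μ (S i) (S j) else hinge K μ (S j) (S i)

lemma sum_sum_pairHinge (S : Fin n → X × Bool) (μ : Fin p → ℝ) :
    ∑ i, ∑ j, (if i ≠ j then pairHinge K S μ i j else 0) =
      2 * ∑ i, ∑ j, if i < j then hinge K μ (S i) (S j) else 0 := by
  have h (i j : Fin n) : (if i ≠ j then pairHinge K S μ i j else 0) =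
      (if i < j then hinge K μ (S i) (S j) else 0) +
        if j < i then hinge K μ (S j) (S i) else 0 := by
    rcases lt_trichotomy i j with h | h | h
    · simp [pairHinge, h, h.ne, h.not_gt]
    · simp [h]
    · simp [pairHinge, h, h.ne', h.not_gt]
  simp_rw [h, Finset.sum_add_distrib]
  rw [two_mul]
  congr 1
  exact Finset.sum_comm

/-- The empirical risk is an average, over all ways of splitting the sample into disjoint pairs, of
averages over those pairs. -/
lemma empRisk_eq_average {m : ℕ} (hm : 0 < m) (S : Fin (m + m) → X × Bool) (μ : Fin p → ℝ) :
    empRisk K S μ = (∑ σ : Equiv.Perm (Fin (m + m)), ∑ k : Fin m,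
      pairHinge K S μ (σ (finSumFinEquiv (Sum.inl k))) (σ (finSumFinEquiv (Sum.inr k)))) /
        ((m + m).factorial * m) := by
  have hm' : (1 : ℝ) ≤ m := by exact_mod_cast hm
  have hf : ((m + m).factorial : ℝ) ≠ 0 := by positivity
  have h (k : Fin m) := card_mul_sum_perm_apply_apply (pairHinge K S μ)
    (a := finSumFinEquiv (Sum.inl k)) (b := finSumFinEquiv (Sum.inr k))
    (finSumFinEquiv.injective.ne Sum.inl_ne_inr)
  simp only [Fintype.card_fin, sum_sum_pairHinge] at h
  rw [Finset.sum_comm]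
  push_cast at h
  have hk (k : Fin m) : ∑ σ : Equiv.Perm (Fin (m + m)),
      pairHinge K S μ (σ (finSumFinEquiv (Sum.inl k))) (σ (finSumFinEquiv (Sum.inr k))) =
        (m + m).factorial * empRisk K S μ := by
    have h0 : ((m : ℝ) + m) * (m + m - 1) ≠ 0 := by
      have : (0 : ℝ) < m + m - 1 := by linarith
      positivity
    refine mul_left_cancel₀ h0 ?_
    rw [h k, empRisk]
    push_cast
    generalize ((m : ℝ) + m) * (m + m - 1) = c at h0 ⊢
    field_simp
  simp_rw [hk]
  simp
  field_simp

lemma hinge_mem_Icc {K : Fin p → X → X → ℝ} {M W : ℝ} (hK : ∀ j x x', |K j x x'| ≤ M)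
    (hM : 0 ≤ M) {μ : Fin p → ℝ} (hμ : l1norm μ ≤ W) (z z' : X × Bool) :
    hinge K μ z z' ∈ Set.Icc 0 (1 + W * M) := by
  have hip : |ip μ (zmap K z.1 z'.1)| ≤ W * M := by
    refine (Finset.abs_sum_le_sum_abs _ _).trans ?_
    refine le_trans ?_ (mul_le_mul_of_nonneg_right hμ hM)
    rw [l1norm, Finset.sum_mul]
    refine Finset.sum_le_sum fun j _ => ?_
    rw [abs_mul]
    exact mul_le_mul_of_nonneg_left (hK j _ _) (abs_nonneg _)
  have h : |sgn z.2 * sgn z'.2 * ip μ (zmap K z.1 z'.1)| ≤ W * M := by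
    rwa [abs_mul, abs_mul, abs_sgn, abs_sgn, one_mul, one_mul]
  have h0 := (abs_nonneg _).trans h
  exact ⟨le_max_left _ _, max_le (by linarith) (by linarith [(abs_le.1 h).1])⟩

lemma sum_sum_lt_const (c : ℝ) :
    ∑ i : Fin n, ∑ j : Fin n, (if i < j then c else 0) = n * (n - 1) / 2 * c := by
  have h (i : Fin n) : ∑ j : Fin n, (if i < j then c else 0) = (n - 1 - i : ℕ) * c := by
    rw [← Finset.sum_filter, Finset.sum_const, nsmul_eq_mul]
    congr 2
    have : Finset.univ.filter (fun j => i < j) = Finset.Ioi i := by ext; simp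
    rw [this, Fin.card_Ioi]
  simp_rw [h]
  rw [← Finset.sum_mul, ← Nat.cast_sum, Fin.sum_univ_eq_sum_range fun i => n - 1 - i,
    Finset.sum_range_reflect (fun i => i), Finset.sum_range_id]
  congr 1
  rw [Nat.cast_div (Nat.even_mul_pred_self n).two_dvd two_ne_zero]
  rcases n with _ | n <;> simp

lemma empRisk_mem_Icc {B : ℝ} (hn : 2 ≤ n) (S : Fin n → X × Bool) {μ : Fin p → ℝ}
    (h : ∀ z z', hinge K μ z z' ∈ Set.Icc 0 B) : empRisk K S μ ∈ Set.Icc 0 B := by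
  have hn' : (2 : ℝ) ≤ n := by exact_mod_cast hn
  have h1 : (0 : ℝ) < n - 1 := by linarith
  refine ⟨mul_nonneg (by positivity) (Finset.sum_nonneg fun i _ => Finset.sum_nonneg fun j _ => ?_),
    ?_⟩
  · split_ifs
    · exact (h _ _).1
    · exact le_rfl
  · calc empRisk K S μ ≤ (2 / ((n : ℝ) * ((n : ℝ) - 1))) *
          ∑ i : Fin n, ∑ j : Fin n, (if i < j then B else 0) := by
          refine mul_le_mul_of_nonneg_left (Finset.sum_le_sum fun i _ =>
            Finset.sum_le_sum fun j _ => ?_) (by positivity)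
          split_ifs
          · exact (h _ _).2
          · exact le_rfl
      _ = B := by
          rw [sum_sum_lt_const]
          field_simp

lemma empRisk_sub_empRisk_update_le {B : ℝ} (hn : 2 ≤ n) (S : Fin n → X × Bool)
    {μ : Fin p → ℝ} (h : ∀ z z', hinge K μ z z' ∈ Set.Icc 0 B) (i : Fin n) (z : X × Bool) :
    empRisk K S μ - empRisk K (Function.update S i z) μ ≤ 2 * B / n := by
  have hn' : (2 : ℝ) ≤ n := by exact_mod_cast hn
  have h1 : (0 : ℝ) < n - 1 := by linarith
  have hB : 0 ≤ B := (h z z).1.trans (h z z).2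
  have hterm (a b : Fin n) : ((if a < b then hinge K μ (S a) (S b) else 0) -
      if a < b then hinge K μ (Function.update S i z a) (Function.update S i z b) else 0) ≤
        (if a = i then (if i < b then B else 0) else 0) +
          if b = i then (if a < i then B else 0) else 0 := by
    have hnn : (0 : ℝ) ≤ (if a = i then (if i < b then B else 0) else 0) := by
      split_ifs <;> first | exact hB | exact le_rfl
    have hnn' : (0 : ℝ) ≤ (if b = i then (if a < i then B else 0) else 0) := by
      split_ifs <;> first | exact hB | exact le_rfl
    by_cases hab : a < b
    · have e1 := (h (S a) (S b)).2
      have e2 := (h (Function.update S i z a) (Function.update S i z b)).1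
      by_cases ha : a = i
      · subst ha
        simp only [hab, if_true] at hnn' ⊢
        linarith
      · by_cases hb : b = i
        · subst hb
          simp only [hab, if_true] at hnn ⊢
          linarith
        · simp [ha, hb]
    · simp only [hab, if_false, sub_zero]
      exact add_nonneg hnn hnn'
  have hcount : ∑ a : Fin n, ∑ b : Fin n, ((if a = i then (if i < b then B else 0) else 0) +
      if b = i then (if a < i then B else 0) else 0) = (n - 1) * B := by
    have e (b : Fin n) : (if i < b then B else 0) + (if b < i then B else 0) =
        B - if b = i then B else 0 := by
      rcases lt_trichotomy i b with h | h | h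
      · simp [h, h.ne', h.not_gt]
      · simp [h]
      · simp [h, h.ne, h.not_gt]
    simp_rw [Finset.sum_add_distrib]
    rw [Finset.sum_comm]
    simp only [Finset.sum_ite_eq', Finset.mem_univ, if_true]
    rw [← Finset.sum_add_distrib]
    simp_rw [e]
    simp
    ring
  calc _ = (2 / ((n : ℝ) * ((n : ℝ) - 1))) * ∑ a : Fin n, ∑ b : Fin n,
        ((if a < b then hinge K μ (S a) (S b) else 0) - if a < b then
          hinge K μ (Function.update S i z a) (Function.update S i z b) else 0) := by
        simp only [empRisk, Finset.sum_sub_distrib, mul_sub]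
    _ ≤ (2 / ((n : ℝ) * ((n : ℝ) - 1))) * ((n - 1) * B) := by
        rw [← hcount]
        exact mul_le_mul_of_nonneg_left (Finset.sum_le_sum fun a _ =>
          Finset.sum_le_sum fun b _ => hterm a b) (by positivity)
    _ = _ := by field_simp

end Hinge

section Risk

open ProbabilityTheory
open scoped NNReal

variable {X : Type*} [MeasurableSpace X] {p n : ℕ} (K : Fin p → X → X → ℝ)

/-- The label-signed feature vector of a pair of labelled points. -/
def signedFeature (q : (X × Bool) × (X × Bool)) (j : Fin p) : ℝ :=
  sgn q.1.2 * sgn q.2.2 * K j q.1.1 q.2.1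

omit [MeasurableSpace X] in
lemma hinge_eq (μ : Fin p → ℝ) (z z' : X × Bool) :
    hinge K μ z z' = max 0 (1 - ip μ (signedFeature K (z, z'))) := by
  unfold hinge ip signedFeature zmap
  rw [Finset.mul_sum]
  congr 2
  exact Finset.sum_congr rfl fun j _ => by ring

omit [MeasurableSpace X] in
lemma abs_signedFeature (q : (X × Bool) × (X × Bool)) (j : Fin p) :
    |signedFeature K q j| = |K j q.1.1 q.2.1| := by
  rw [signedFeature, abs_mul, abs_mul, abs_sgn, abs_sgn, one_mul, one_mul]

variable {K} (hKm : ∀ i, Measurable (fun w : X × X => K i w.1 w.2))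
include hKm

lemma measurable_signedFeature (j : Fin p) : Measurable fun q => signedFeature K q j :=
  ((measurable_sgn.comp measurable_fst.snd).mul (measurable_sgn.comp measurable_snd.snd)).mul
    ((hKm j).comp (measurable_fst.fst.prodMk measurable_snd.fst))

lemma measurable_hinge (μ : Fin p → ℝ) :
    Measurable fun q : (X × Bool) × (X × Bool) => hinge K μ q.1 q.2 := by
  simp only [hinge_eq]
  refine measurable_const.max (measurable_const.sub ?_)
  exact Finset.measurable_fun_sum _ fun j _ =>
    (measurable_signedFeature hKm j).const_mul (μ j)

lemma measurable_hinge_apply (μ : Fin p → ℝ) (i j : Fin n) :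
    Measurable fun S : Fin n → X × Bool => hinge K μ (S i) (S j) :=
  (measurable_hinge hKm μ).comp (f := fun S : Fin n → X × Bool => (S i, S j))
    (.prodMk (measurable_pi_apply i) (measurable_pi_apply j))

lemma measurable_empRisk (μ : Fin p → ℝ) :
    Measurable fun S : Fin n → X × Bool => empRisk K S μ := by
  refine (Finset.measurable_fun_sum _ fun i _ => Finset.measurable_fun_sum _ fun j _ => ?_).const_mul _
  split_ifs
  · exact measurable_hinge_apply hKm μ i j
  · exact measurable_const

variable (D : Measure (X × Bool)) [IsProbabilityMeasure D] {M : ℝ≥0} (hM0 : 0 < M)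
  (hK : ∀ j x x', |K j x x'| ≤ M)
include hK

lemma integrable_hinge (μ : Fin p → ℝ) :
    Integrable (fun q : (X × Bool) × (X × Bool) => hinge K μ q.1 q.2) (D.prod D) :=
  integrable_of_measurable_of_mem_Icc (measurable_hinge hKm μ)
    fun q => hinge_mem_Icc hK M.2 le_rfl q.1 q.2

lemma trueRisk_mem_Icc {μ : Fin p → ℝ} {W : ℝ} (hμ : l1norm μ ≤ W) :
    trueRisk K D μ ∈ Set.Icc 0 (1 + W * M) := by
  refine ⟨integral_nonneg fun q => (hinge_mem_Icc hK M.2 hμ q.1 q.2).1, ?_⟩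
  simpa [trueRisk] using integral_mono (integrable_hinge hKm D hK μ)
    (integrable_const (1 + W * M)) fun q => (hinge_mem_Icc hK M.2 hμ q.1 q.2).2

lemma continuousOn_trueRisk {W : ℝ} :
    ContinuousOn (trueRisk K D) {μ | l1norm μ ≤ W} := by
  refine continuousOn_of_dominated (bound := fun _ => 1 + W * M)
    (fun μ _ => (measurable_hinge hKm μ).aestronglyMeasurable)
    (fun μ hμ => Filter.Eventually.of_forall fun q => ?_) (integrable_const _)
    (Filter.Eventually.of_forall fun q => ?_)
  · have := hinge_mem_Icc hK M.2 hμ q.1 q.2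
    rw [Real.norm_eq_abs, abs_of_nonneg this.1]
    exact this.2
  · unfold hinge ip
    fun_prop

include hM0 in
/-- Symmetrization after averaging over all ways of pairing up the sample. -/
lemma integral_ciSup_trueRisk_sub_empRisk_le {ι : Type*} [Finite ι] [Nonempty ι] (hp : 3 ≤ p)
    {m : ℕ} (hm : 0 < m) (θ : ι → Fin p → ℝ) (hθ : ∀ i j, 0 ≤ θ i j) {W : ℝ} (hW0 : 0 ≤ W)
    (hW : ∀ i, l1norm (θ i) ≤ W) :
    ∫ S, ⨆ i, (trueRisk K D (θ i) - empRisk K S (θ i))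
        ∂(Measure.pi fun _ : Fin (m + m) => D) ≤
      W * √(2 * (m * (M ^ 2 + M ^ 2)) * Real.log p) / m := by
  have hm' : (0 : ℝ) < m := by exact_mod_cast hm
  have hf : (0 : ℝ) < (m + m).factorial := by positivity
  set bound := W * √(2 * (m * (M ^ 2 + M ^ 2)) * Real.log p)
  set Pn := Measure.pi fun _ : Fin (m + m) => D
  set l : Fin m → Fin (m + m) := fun k => finSumFinEquiv (Sum.inl k)
  set r : Fin m → Fin (m + m) := fun k => finSumFinEquiv (Sum.inr k)
  set T : Equiv.Perm (Fin (m + m)) → (Fin (m + m) → X × Bool) → ℝ := fun σ S =>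
    ⨆ i, ∑ k, (trueRisk K D (θ i) - pairHinge K S (θ i) (σ (l k)) (σ (r k))) with hT
  have hTi (σ) : Integrable (T σ) Pn := by
    refine integrable_ciSup_of_finite fun i => integrable_finsetSum _ fun k _ =>
      (integrable_const _).sub ?_
    refine integrable_of_measurable_of_mem_Icc (a := 0) (b := 1 + W * M) ?_ fun S => ?_
    · unfold pairHinge
      split_ifs <;> exact measurable_hinge_apply hKm _ _ _
    · unfold pairHinge
      split_ifs <;> exact hinge_mem_Icc hK M.2 (hW i) _ _
  have hTle (σ) : ∫ S, T σ S ∂Pn ≤ bound := by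
    set v : Fin m → (X × Bool) × (X × Bool) → Fin p → ℝ := fun k q =>
      if σ (l k) < σ (r k) then signedFeature K q else signedFeature K q.swap
    have hv (k j) : Measurable fun q => v k q j := by
      by_cases h : σ (l k) < σ (r k)
      · simpa [v, h] using measurable_signedFeature hKm j
      · simpa [v, h, Function.comp_def] using (measurable_signedFeature hKm j).comp measurable_swap
    have hvM (k q j) : |v k q j| ≤ M := by
      by_cases h : σ (l k) < σ (r k)
      · simpa [v, h, abs_signedFeature] using hK _ _ _
      · simpa [v, h, abs_signedFeature] using hK _ _ _
    have hrisk (k i) : ∫ q, max 0 (1 - ip (θ i) (v k q)) ∂(D.prod D) = trueRisk K D (θ i) := by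
      by_cases h : σ (l k) < σ (r k)
      · simp [v, h, trueRisk, hinge_eq]
      · simp only [v, h, if_false, trueRisk, hinge_eq]
        exact integral_prod_swap fun q => max 0 (1 - ip (θ i) (signedFeature K q))
    have hpair (S : Fin (m + m) → X × Bool) (k i) :
        pairHinge K S (θ i) (σ (l k)) (σ (r k)) =
          max 0 (1 - ip (θ i) (v k (S (σ (l k)), S (σ (r k))))) := by
      by_cases h : σ (l k) < σ (r k)
      · simp [pairHinge, v, h, hinge_eq]
      · simp [pairHinge, v, h, hinge_eq]
    have hmp := measurePreserving_pairs D (finSumFinEquiv.trans σ : Fin m ⊕ Fin m ≃ Fin (m + m))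
    have hmain := integral_ciSup_sum_hinge_le (D.prod D) hp hm v hv hM0 hvM θ hθ hW0 hW
    simp only [hrisk] at hmain
    rw [← hmp.map_eq, integral_map hmp.measurable.aemeasurable] at hmain
    · simp only [hT, hpair]
      exact hmain
    · refine (Measurable.iSup fun i => Finset.measurable_fun_sum _ fun k _ => ?_).aestronglyMeasurable
      refine measurable_const.sub (measurable_const.max (measurable_const.sub ?_))
      exact Finset.measurable_fun_sum _ fun j _ =>
        ((hv k j).comp (measurable_pi_apply k)).const_mul _
  have hpt (S : Fin (m + m) → X × Bool) : ⨆ i, (trueRisk K D (θ i) - empRisk K S (θ i)) ≤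
      (∑ σ, T σ S) / ((m + m).factorial * m) := by
    refine ciSup_le fun i => ?_
    have hle : ∑ σ : Equiv.Perm (Fin (m + m)),
        ∑ k, (trueRisk K D (θ i) - pairHinge K S (θ i) (σ (l k)) (σ (r k))) ≤ ∑ σ, T σ S :=
      Finset.sum_le_sum fun σ _ => le_ciSup_of_finite (fun i =>
        ∑ k, (trueRisk K D (θ i) - pairHinge K S (θ i) (σ (l k)) (σ (r k)))) i
    refine le_trans (le_of_eq ?_) (div_le_div_of_nonneg_right hle (by positivity))
    rw [empRisk_eq_average K hm]
    simp only [Finset.sum_sub_distrib, sub_div]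
    congr 1
    simp [Fintype.card_perm]
    field_simp
  have hFi : Integrable (fun S => ⨆ i, (trueRisk K D (θ i) - empRisk K S (θ i))) Pn :=
    integrable_ciSup_of_finite fun i => (integrable_const _).sub <|
      integrable_of_measurable_of_mem_Icc (measurable_empRisk hKm _) fun S =>
        empRisk_mem_Icc K (by omega) S fun z z' => hinge_mem_Icc hK M.2 (hW i) z z'
  calc _ ≤ ∫ S, (∑ σ, T σ S) / ((m + m).factorial * m) ∂Pn :=
        integral_mono hFi ((integrable_finsetSum _ fun σ _ => hTi σ).div_const _) hpt
    _ = (∑ σ, ∫ S, T σ S ∂Pn) / ((m + m).factorial * m) := by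
        rw [integral_div, integral_finsetSum _ fun σ _ => hTi σ]
    _ ≤ (∑ _σ : Equiv.Perm (Fin (m + m)), bound) / ((m + m).factorial * m) := by
        gcongr with σ
        exact hTle σ
    _ = bound / m := by
        simp [Fintype.card_perm]
        field_simp

include hM0 in
/-- High-probability uniform deviation bound over a finite subset of an `ℓ₁`-ball. -/
lemma measure_ciSup_trueRisk_sub_empRisk_ge_le {ι : Type*} [Finite ι] [Nonempty ι] (hp : 3 ≤ p)
    {m : ℕ} (hm : 0 < m) (θ : ι → Fin p → ℝ) (hθ : ∀ i j, 0 ≤ θ i j) {W : ℝ} (hW0 : 0 ≤ W)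
    (hW : ∀ i, l1norm (θ i) ≤ W) {δ : ℝ} (hδ0 : 0 < δ) (hδ1 : δ < 1) :
    (Measure.pi fun _ : Fin (m + m) => D) {S | W * √(2 * (m * (M ^ 2 + M ^ 2)) * Real.log p) / m +
        (1 + W * M) * √(2 * Real.log (1 / δ) / (m + m)) ≤
          ⨆ i, (trueRisk K D (θ i) - empRisk K S (θ i))} ≤ ENNReal.ofReal δ := by
  have hm' : (0 : ℝ) < m := by exact_mod_cast hm
  set Pn := Measure.pi fun _ : Fin (m + m) => D
  set F : (Fin (m + m) → X × Bool) → ℝ := fun S => ⨆ i, (trueRisk K D (θ i) - empRisk K S (θ i))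
  have hB : 0 < 1 + W * M := by positivity
  obtain ⟨B, hBdef⟩ : ∃ B : ℝ≥0, (B : ℝ) = 1 + W * M := ⟨⟨_, hB.le⟩, rfl⟩
  have hh (i) (z z') : hinge K (θ i) z z' ∈ Set.Icc 0 (1 + W * M) :=
    hinge_mem_Icc hK M.2 (hW i) z z'
  have hFm : Measurable F :=
    Measurable.iSup fun i => (measurable_empRisk hKm (θ i)).const_sub _
  have hFb (S) : F S ∈ Set.Icc (-(1 + W * M)) (1 + W * M) := by
    obtain ⟨i, hi⟩ := exists_eq_ciSup_of_finite
      (f := fun i => trueRisk K D (θ i) - empRisk K S (θ i))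
    have h1 := trueRisk_mem_Icc hKm D hK (hW i)
    have h2 := empRisk_mem_Icc K (by omega) S (hh i)
    rw [show F S = _ from hi.symm]
    constructor <;> linarith [h1.1, h1.2, h2.1, h2.2]
  have hFd (S : Fin (m + m) → X × Bool) (i z) :
      F (Function.update S i z) - F S ≤ (B / m : ℝ≥0) := by
    rw [sub_le_iff_le_add]
    refine ciSup_le fun k => ?_
    have h1 := empRisk_sub_empRisk_update_le K (by omega) S (hh k) i z
    have h2 := le_ciSup_of_finite (fun i => trueRisk K D (θ i) - empRisk K S (θ i)) k
    have h3 : 2 * (1 + W * M) / ((m + m : ℕ) : ℝ) = (B / m : ℝ≥0) := by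
      push_cast
      rw [hBdef]
      field_simp
      ring
    rw [h3] at h1
    change _ ≤ F S at h2
    linarith
  have hsub := hasSubgaussianMGF_of_bounded_differences D hFm hFb hFd
  have hEF := integral_ciSup_trueRisk_sub_empRisk_le hKm D hM0 hK hp hm θ hθ hW0 hW
  set L := Real.log (1 / δ) with hLdef
  have hL : 0 ≤ L := Real.log_nonneg (by rw [le_div_iff₀ hδ0]; linarith)
  have htail := hsub.measure_ge_le (ε := (1 + W * M) * √(2 * L / (m + m))) (by positivity)
  have hexp : Real.exp (-((1 + W * M) * √(2 * L / (m + m))) ^ 2 /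
      (2 * ((((m + m : ℕ) : ℝ≥0) * (B / m / 2) ^ 2 : ℝ≥0) : ℝ))) = δ := by
    rw [← Real.exp_log hδ0]
    congr 1
    rw [mul_pow, Real.sq_sqrt (by positivity)]
    push_cast
    rw [hBdef]
    have : Real.log δ = -L := by rw [hLdef, one_div, Real.log_inv, neg_neg]
    rw [this]
    field_simp
    ring
  rw [hexp] at htail
  refine le_trans (measure_mono fun S hS => ?_)
    ((ENNReal.le_ofReal_iff_toReal_le (measure_ne_top _ _) hδ0.le).2 htail)
  simp only [Set.mem_ofPred_eq] at hS ⊢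
  change ∫ S, F S ∂Pn ≤ _ at hEF
  linarith

end Risk

section Uniform

open scoped NNReal

variable {X : Type*} {p : ℕ} {K : Fin p → X → X → ℝ}

/-- Comparing with the zero vector bounds the `ℓ₁`-norm of a regularized minimizer. -/
lemma l1norm_le_of_le_objective_zero {n : ℕ} (hn : 2 ≤ n) {S : Fin n → X × Bool} {lam : ℝ}
    (hlam : 0 < lam) {μ : Fin p → ℝ}
    (h : lam / 2 * l1norm μ + empRisk K S μ ≤
      lam / 2 * l1norm (0 : Fin p → ℝ) + empRisk K S 0) : l1norm μ ≤ 2 / lam := by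
  have hn' : (2 : ℝ) ≤ n := by exact_mod_cast hn
  have h1 : (0 : ℝ) < n - 1 := by linarith
  have hzero : empRisk K S 0 ≤ 1 :=
    (empRisk_mem_Icc K hn S (B := 1) fun z z' => by simp [hinge, ip]).2
  have hnonneg : 0 ≤ empRisk K S μ :=
    mul_nonneg (by positivity) (Finset.sum_nonneg fun i _ => Finset.sum_nonneg fun j _ => by
      split_ifs
      · exact le_max_left _ _
      · exact le_rfl)
  have hl : l1norm (0 : Fin p → ℝ) = 0 := by simp [l1norm]
  rw [hl] at h
  rw [le_div_iff₀ hlam]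
  linarith

variable [MeasurableSpace X]

/-- High-probability uniform deviation bound over the nonnegative part of an `ℓ₁`-ball. -/
lemma ofReal_one_sub_le_measure_forall_trueRisk_le
    (hKm : ∀ i, Measurable (fun w : X × X => K i w.1 w.2))
    (D : Measure (X × Bool)) [IsProbabilityMeasure D] {M : ℝ≥0} (hM0 : 0 < M)
    (hK : ∀ j x x', |K j x x'| ≤ M) (hp : 3 ≤ p) {m : ℕ} (hm : 0 < m) {W : ℝ} (hW0 : 0 ≤ W)
    {δ : ℝ} (hδ0 : 0 < δ) (hδ1 : δ < 1) :
    ENNReal.ofReal (1 - δ) ≤ (Measure.pi fun _ : Fin (m + m) => D)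
      {S | ∀ μ : Fin p → ℝ, (∀ j, 0 ≤ μ j) → l1norm μ ≤ W → trueRisk K D μ - empRisk K S μ ≤
        W * √(2 * (m * (M ^ 2 + M ^ 2)) * Real.log p) / m +
          (1 + W * M) * √(2 * Real.log (1 / δ) / (m + m))} := by
  set ε := W * √(2 * (m * (M ^ 2 + M ^ 2)) * Real.log p) / m +
    (1 + W * M) * √(2 * Real.log (1 / δ) / (m + m))
  set Pn := Measure.pi fun _ : Fin (m + m) => D
  set s : Set (Fin p → ℝ) := {μ | (∀ j, 0 ≤ μ j) ∧ l1norm μ ≤ W}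
  have : Nonempty s := ⟨0, fun _ => le_rfl, by simpa [l1norm] using hW0⟩
  set θ : ℕ → s := TopologicalSpace.denseSeq s
  set E : ℕ → Set (Fin (m + m) → X × Bool) := fun N =>
    ⋃ k ∈ Set.Iic N, {S | ε < trueRisk K D (θ k) - empRisk K S (θ k)} with hE
  have hEle (N) : Pn (E N) ≤ ENNReal.ofReal δ := by
    refine le_trans (measure_mono ?_) (measure_ciSup_trueRisk_sub_empRisk_ge_le hKm D hM0 hK hp hm
      (fun k : Set.Iic N => (θ k : Fin p → ℝ)) (fun k => (θ k).2.1) hW0 (fun k => (θ k).2.2)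
      hδ0 hδ1)
    intro S hS
    simp only [hE, Set.mem_iUnion] at hS
    obtain ⟨k, hk, hS⟩ := hS
    exact hS.le.trans (le_ciSup_of_finite (fun k : Set.Iic N =>
      trueRisk K D (θ k) - empRisk K S (θ k)) ⟨k, hk⟩)
  have hmono : Monotone E := fun N N' h =>
    Set.biUnion_subset_biUnion_left (Set.Iic_subset_Iic.2 h)
  have hU : Pn (⋃ N, E N) ≤ ENNReal.ofReal δ := by
    rw [hmono.measure_iUnion]
    exact iSup_le hEle
  have hUm : MeasurableSet (⋃ N, E N) :=
    .iUnion fun N => .biUnion (Set.to_countable _) fun k _ =>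
      measurableSet_lt measurable_const ((measurable_empRisk hKm (θ k)).const_sub _)
  calc ENNReal.ofReal (1 - δ) = 1 - ENNReal.ofReal δ := by
        rw [ENNReal.ofReal_sub _ hδ0.le, ENNReal.ofReal_one]
    _ ≤ 1 - Pn (⋃ N, E N) := tsub_le_tsub_left hU 1
    _ = Pn (⋃ N, E N)ᶜ := (prob_compl_eq_one_sub hUm).symm
    _ ≤ _ := by
      refine measure_mono fun S hS μ hμ0 hμW => ?_
      have hcont : Continuous fun μ : s => trueRisk K D μ - empRisk K S μ := by
        refine (continuousOn_iff_continuous_domRestrict.1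
          ((continuousOn_trueRisk hKm D hK (W := W)).mono fun μ hμ => hμ.2)).sub ?_
        have hemp : Continuous fun μ : Fin p → ℝ => empRisk K S μ := by
          unfold empRisk hinge ip
          refine continuous_const.mul (continuous_finsetSum _ fun i _ =>
            continuous_finsetSum _ fun j _ => ?_)
          split_ifs <;> fun_prop
        exact hemp.comp continuous_subtype_val
      have hk (k : ℕ) : trueRisk K D (θ k) - empRisk K S (θ k) ≤ ε := by
        by_contra! h
        exact hS (Set.mem_iUnion.2 ⟨k, Set.mem_biUnion (Set.mem_Iic.2 le_rfl) h⟩)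
      have hclosed : IsClosed {μ : s | trueRisk K D μ - empRisk K S μ ≤ ε} :=
        isClosed_le hcont continuous_const
      have := hclosed.closure_subset_iff.2 (Set.range_subset_iff.2 hk)
        (TopologicalSpace.denseRange_denseSeq s ⟨μ, hμ0, hμW⟩)
      exact this

end Uniform

/-- generalization bound for the L1-regularized empirical risk minimizer. -/
theorem stmt13 {X : Type*} [MeasurableSpace X] {p n : ℕ} (hp : 3 ≤ p)
    (hn : 2 ≤ n) (hev : Even n)
    (K : Fin p → X → X → ℝ)
    (hKm : ∀ i, Measurable (fun w : X × X => K i w.1 w.2))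
    (κ : Fin p → ℝ) (hκ : ∀ i, 0 < κ i)
    (hKb : ∀ i x x', |K i x x'| ≤ κ i ^ 2)
    (D : Measure (X × Bool)) [IsProbabilityMeasure D]
    (lam : ℝ) (hlam : 0 < lam) (δ : ℝ) (hδ0 : 0 < δ) (hδ1 : δ < 1) :
    ENNReal.ofReal (1 - δ) ≤
      (Measure.pi fun _ : Fin n => D) {S | ∀ muh : Fin p → ℝ, (∀ i, 0 ≤ muh i) →
        (∀ μ : Fin p → ℝ, (∀ i, 0 ≤ μ i) →
          lam / 2 * l1norm muh + empRisk K S muh ≤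
            lam / 2 * l1norm μ + empRisk K S μ) →
        trueRisk K D muh ≤ empRisk K S muh +
          (4 * linfnorm (fun i => κ i ^ 2) / lam) * Real.sqrt (2 * Real.log p / n) +
          (1 + 2 * linfnorm (fun i => κ i ^ 2) / lam) *
            Real.sqrt (2 * Real.log (1 / δ) / n)} := by
  obtain ⟨m, rfl⟩ := hev
  have hm : 0 < m := by omega
  have : Nonempty (Fin p) := ⟨⟨0, by omega⟩⟩
  have hle (i) : κ i ^ 2 ≤ linfnorm (fun i => κ i ^ 2) :=
    (le_abs_self _).trans (le_ciSup_of_finite (fun i => |κ i ^ 2|) i)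
  have hpos : 0 < linfnorm (fun i => κ i ^ 2) :=
    (pow_pos (hκ ⟨0, by omega⟩) 2).trans_le (hle _)
  obtain ⟨M, hM⟩ : ∃ M : NNReal, (M : ℝ) = linfnorm (fun i => κ i ^ 2) := ⟨⟨_, hpos.le⟩, rfl⟩
  rw [← hM] at hpos ⊢
  have hm' : (0 : ℝ) < m := by exact_mod_cast hm
  have hlog : 0 ≤ Real.log p := Real.log_natCast_nonneg p
  refine (ofReal_one_sub_le_measure_forall_trueRisk_le hKm D (NNReal.coe_pos.1 hpos)
    (fun j x x' => (hKb j x x').trans ((hle j).trans_eq hM.symm)) hp hm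
    (W := 2 / lam) (by positivity) hδ0 hδ1).trans (measure_mono fun S hS muh hmuh hmin => ?_)
  have hdev := hS muh hmuh (l1norm_le_of_le_objective_zero hn hlam (hmin 0 fun _ => le_rfl))
  have hA : 2 / lam * √(2 * (m * ((M : ℝ) ^ 2 + M ^ 2)) * Real.log p) / m =
      4 * M / lam * √(2 * Real.log p / (m + m)) := by
    have : 2 * (m * ((M : ℝ) ^ 2 + M ^ 2)) * Real.log p =
        (2 * M * m) ^ 2 * (2 * Real.log p / (m + m)) := by
      field_simp
      ring
    rw [this, Real.sqrt_mul (by positivity), Real.sqrt_sq (by positivity)]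
    field_simp
    ring
  rw [hA, show 2 / lam * (M : ℝ) = 2 * M / lam by ring] at hdev
  push_cast
  linarith
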